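/- arXiv:2006.12180 — 2 statements merged into one kernel-verified Lean document; each statement's English description precedes it below -/
import Mathlib

section
/- Let d ≥ 1 be an integer, μ ∈ ℝ^d, Σ a symmetric positive definite real d×d matrix, and θ ∈ (0,1). Then the MTIN density integrates to one: ∫_{ℝ^d} f_TIN(x; μ, Σ, θ) dx = 1 (the integrand being defined for x ≠ μ, a set of full Lebesgue measure). -/
open MeasureTheory Real Filter Set Matrix

/-- Upper incomplete gamma function `Γ(s, x) = ∫ₓ^∞ t^(s-1) e^(-t) dt`. -/
noncomputable def uGamma (s x : ℝ) : ℝ := ∫ t in Set.Ioi x, t ^ (s - 1) * Real.exp (-t)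

/-- Squared Mahalanobis distance `δ(x) = (x-μ)ᵀ Σ⁻¹ (x-μ)`. -/
noncomputable def mahal {d : ℕ} (μ : Fin d → ℝ) (S : Matrix (Fin d) (Fin d) ℝ)
    (x : Fin d → ℝ) : ℝ :=
  (x - μ) ⬝ᵥ (S⁻¹ *ᵥ (x - μ))

/-- The multivariate tail-inflated normal (MTIN) density. -/
noncomputable def mtin (d : ℕ) (μ : Fin d → ℝ) (S : Matrix (Fin d) (Fin d) ℝ) (θ : ℝ)
    (x : Fin d → ℝ) : ℝ :=
  2 * Real.pi ^ (-(d : ℝ) / 2) * S.det ^ (-(1 : ℝ) / 2) /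
      (θ * mahal μ S x ^ ((d : ℝ) / 2 + 1)) *
    (uGamma ((d : ℝ) / 2 + 1) ((1 - θ) * mahal μ S x / 2) -
      uGamma ((d : ℝ) / 2 + 1) (mahal μ S x / 2))

lemma exists_transpose_mul_self_of_posDef {ι : Type*} [Fintype ι] [DecidableEq ι]
    {A : Matrix ι ι ℝ} (hA : A.PosDef) : ∃ B : Matrix ι ι ℝ, A = Bᵀ * B := by
  open scoped MatrixOrder in
  obtain ⟨B, hB⟩ := CStarAlgebra.nonneg_iff_eq_star_mul_self.mp hA.posSemidef.nonneg
  exact ⟨B, by simpa [star_eq_conjTranspose] using hB⟩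

lemma integral_comp_mulVec {ι : Type*} [Fintype ι] [DecidableEq ι] {B : Matrix ι ι ℝ}
    (hB : B.det ≠ 0) (f : (ι → ℝ) → ℝ) (hf : Continuous f) :
    ∫ x, f (B *ᵥ x) = |B.det|⁻¹ * ∫ x, f x := by
  have h := integral_map (μ := volume) (φ := toLin' B)
    (LinearMap.continuous_of_finiteDimensional _).aemeasurable (f := f)
    hf.aestronglyMeasurable
  rw [Real.map_matrix_volume_pi_eq_smul_volume_pi hB, integral_smul_measure,
    ENNReal.toReal_ofReal (abs_nonneg _), abs_inv, smul_eq_mul] at h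
  simpa only [toLin'_apply] using h.symm

lemma integral_exp_neg_mul_quadraticForm {ι : Type*} [Fintype ι] [DecidableEq ι]
    {A : Matrix ι ι ℝ} (hA : A.PosDef) (m : ι → ℝ) {b : ℝ} (hb : 0 < b) :
    ∫ x, Real.exp (-b * ((x - m) ⬝ᵥ (A *ᵥ (x - m)))) =
      (π / b) ^ ((Fintype.card ι : ℝ) / 2) * A.det ^ (-(1 : ℝ) / 2) := by
  obtain ⟨B, rfl⟩ := exists_transpose_mul_self_of_posDef hA
  have hdet : B.det ≠ 0 := fun h ↦ hA.det_pos.ne' (by simp [h])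
  have hform (y : ι → ℝ) : Real.exp (-b * (y ⬝ᵥ ((Bᵀ * B) *ᵥ y))) =
      ∏ i, Real.exp (-b * (B *ᵥ y) i ^ 2) := by
    rw [← Real.exp_sum, ← Finset.mul_sum, ← mulVec_mulVec, dotProduct_mulVec, vecMul_transpose]
    simp only [dotProduct, sq]
  rw [integral_sub_right_eq_self (fun y ↦ Real.exp (-b * (y ⬝ᵥ ((Bᵀ * B) *ᵥ y))))]
  simp_rw [hform]
  rw [integral_comp_mulVec hdet (fun y ↦ ∏ i, Real.exp (-b * y i ^ 2)) (by fun_prop),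
    integral_fintype_prod_volume_eq_pow (fun t ↦ Real.exp (-b * t ^ 2)), integral_gaussian,
    mul_comm, det_mul, det_transpose, ← sq, ← sq_abs, Real.sqrt_eq_rpow, ← Real.rpow_natCast,
    ← Real.rpow_mul (by positivity), ← Real.rpow_natCast |B.det|, ← Real.rpow_mul (abs_nonneg _),
    ← Real.rpow_neg_one |B.det|]
  congr 2 <;> push_cast <;> ring

lemma uGamma_sub_uGamma {s a b : ℝ} (hs : 0 < s) (ha : 0 ≤ a) (hab : a ≤ b) :
    uGamma s a - uGamma s b = ∫ t in a..b, t ^ (s - 1) * Real.exp (-t) := by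
  refine intervalIntegral.integral_Ioi_sub_Ioi ?_ hab
  have h := (Real.GammaIntegral_convergent hs).mono_set (Ioi_subset_Ioi ha)
  simpa only [mul_comm] using h

/-- The MTIN density as a mixture of normal densities with covariance `w⁻¹ • S`, the weight `w`
being uniform on `(1 - θ, 1)`. -/
lemma mtin_eq_intervalIntegral {d : ℕ} {m : Fin d → ℝ} {S : Matrix (Fin d) (Fin d) ℝ} {θ : ℝ}
    (hθ : θ ∈ Ioo (0 : ℝ) 1) {x : Fin d → ℝ} (hx : 0 < mahal m S x) :
    mtin d m S θ x = ∫ w in (1 - θ)..1,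
      θ⁻¹ * S.det ^ (-(1 : ℝ) / 2) * (w / (2 * π)) ^ ((d : ℝ) / 2) *
        Real.exp (-(w / 2) * mahal m S x) := by
  obtain ⟨h0, h1⟩ := hθ
  set δ := mahal m S x with hδ
  have hsub : uGamma ((d : ℝ) / 2 + 1) ((1 - θ) * δ / 2) - uGamma ((d : ℝ) / 2 + 1) (δ / 2) =
      (δ / 2) * ∫ w in (1 - θ)..1,
        (δ / 2 * w) ^ ((d : ℝ) / 2) * Real.exp (-(δ / 2 * w)) := by
    rw [uGamma_sub_uGamma (by positivity) (by nlinarith) (by nlinarith), ← smul_eq_mul (δ / 2),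
      intervalIntegral.smul_integral_comp_mul_left
        (fun t ↦ t ^ ((d : ℝ) / 2) * Real.exp (-t))]
    congr 1 <;> ring_nf
  rw [mtin, ← hδ, hsub, ← mul_assoc, ← intervalIntegral.integral_const_mul]
  refine intervalIntegral.integral_congr fun w hw ↦ ?_
  rw [uIcc_of_le (by linarith)] at hw
  have hw0 : 0 < w := by linarith [hw.1]
  have hπ := Real.pi_pos
  rw [Real.rpow_add_one hx.ne', Real.mul_rpow (by positivity) hw0.le,
    Real.div_rpow hx.le zero_le_two, Real.div_rpow hw0.le (by positivity),
    Real.mul_rpow zero_le_two hπ.le, neg_div, Real.rpow_neg hπ.le]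
  have : -(w / 2) * δ = -(δ / 2 * w) := by ring
  rw [this]
  have := Real.rpow_pos_of_pos hx ((d : ℝ) / 2)
  have := Real.rpow_pos_of_pos hπ ((d : ℝ) / 2)
  have := Real.rpow_pos_of_pos (zero_lt_two (α := ℝ)) ((d : ℝ) / 2)
  field_simp

lemma continuous_mahal {d : ℕ} (m : Fin d → ℝ) (S : Matrix (Fin d) (Fin d) ℝ) :
    Continuous (mahal m S) := by
  unfold mahal
  fun_prop

lemma mahal_pos {d : ℕ} {m : Fin d → ℝ} {S : Matrix (Fin d) (Fin d) ℝ} (hS : S.PosDef)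
    {x : Fin d → ℝ} (hx : x ≠ m) : 0 < mahal m S x := by
  simpa [mahal] using hS.inv.dotProduct_mulVec_pos (sub_ne_zero.mpr hx)

lemma integral_normal_density_mahal {d : ℕ} (m : Fin d → ℝ) {S : Matrix (Fin d) (Fin d) ℝ}
    (hS : S.PosDef) (c : ℝ) {w : ℝ} (hw : 0 < w) :
    ∫ x, c * S.det ^ (-(1 : ℝ) / 2) * (w / (2 * π)) ^ ((d : ℝ) / 2) *
      Real.exp (-(w / 2) * mahal m S x) = c := by
  have hdet := hS.det_pos
  have hcancel : (w / (2 * π)) ^ ((d : ℝ) / 2) * (π / (w / 2)) ^ ((d : ℝ) / 2) = 1 := by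
    rw [← Real.mul_rpow (by positivity) (by positivity)]
    have : w / (2 * π) * (π / (w / 2)) = 1 := by field_simp
    rw [this, Real.one_rpow]
  have hcancel_det : S.det ^ (-(1 : ℝ) / 2) * S⁻¹.det ^ (-(1 : ℝ) / 2) = 1 := by
    rw [← Real.mul_rpow hdet.le hS.inv.det_pos.le, ← det_mul,
      mul_nonsing_inv _ hdet.ne'.isUnit, det_one, Real.one_rpow]
  have hgauss := integral_exp_neg_mul_quadraticForm hS.inv m (half_pos hw)
  rw [Fintype.card_fin] at hgauss
  rw [integral_const_mul]
  simp only [mahal]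
  rw [hgauss]
  linear_combination c * hcancel * S.det ^ (-(1 : ℝ) / 2) * S⁻¹.det ^ (-(1 : ℝ) / 2) + c * hcancel_det

/-- The MTIN density integrates to one over ℝ^d (w.r.t. Lebesgue measure). -/
theorem mtin_integral_eq_one (d : ℕ) (hd : 1 ≤ d) (μ : Fin d → ℝ)
    (S : Matrix (Fin d) (Fin d) ℝ) (hS : S.PosDef) (θ : ℝ) (hθ : θ ∈ Set.Ioo (0 : ℝ) 1) :
    ∫ x : Fin d → ℝ, mtin d μ S θ x = 1 := by
  have : Nonempty (Fin d) := ⟨⟨0, hd⟩⟩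
  obtain ⟨h0, h1⟩ := hθ
  have hdet := hS.det_pos
  set g : (Fin d → ℝ) → ℝ → ℝ := fun x w ↦
    θ⁻¹ * S.det ^ (-(1 : ℝ) / 2) * (w / (2 * π)) ^ ((d : ℝ) / 2) *
      Real.exp (-(w / 2) * mahal μ S x) with hg
  set ν : Measure ℝ := volume.restrict (Ioc (1 - θ) 1) with hν
  have hpos : ∀ᵐ w ∂ν, 0 < w :=
    (ae_restrict_iff' measurableSet_Ioc).mpr (.of_forall fun w hw ↦ by linarith [hw.1])
  have hint {w : ℝ} (hw : 0 < w) : ∫ x, g x w = θ⁻¹ := integral_normal_density_mahal μ hS θ⁻¹ hw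
  have hcont : Continuous (Function.uncurry g) := by
    have hm := continuous_mahal μ S
    have hr : Continuous fun w : ℝ ↦ (w / (2 * π)) ^ ((d : ℝ) / 2) :=
      (continuous_id.div_const _).rpow_const fun _ ↦ Or.inr (by positivity)
    exact (continuous_const.mul (hr.comp continuous_snd)).mul (by fun_prop)
  have hprod : Integrable (Function.uncurry g) (volume.prod ν) := by
    rw [integrable_prod_iff' hcont.aestronglyMeasurable]
    constructor
    · filter_upwards [hpos] with w hw
      exact .of_integral_ne_zero (by simpa [Function.uncurry, hint hw] using h0.ne')
    · refine (integrable_const θ⁻¹).congr ?_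
      filter_upwards [hpos] with w hw
      rw [← hint hw]
      refine integral_congr_ae (.of_forall fun x ↦ ?_)
      exact (Real.norm_of_nonneg (by simp only [hg]; positivity)).symm
  have hne : ∀ᵐ x : Fin d → ℝ, x ≠ μ := by
    simp [ae_iff]
  calc ∫ x, mtin d μ S θ x = ∫ x, ∫ w, g x w ∂ν := by
        refine integral_congr_ae ?_
        filter_upwards [hne] with x hx
        rw [mtin_eq_intervalIntegral ⟨h0, h1⟩ (mahal_pos hS hx),
          intervalIntegral.integral_of_le (by linarith)]
    _ = ∫ w, ∫ x : Fin d → ℝ, g x w ∂volume ∂ν := integral_integral_swap hprod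
    _ = ∫ w, θ⁻¹ ∂ν := integral_congr_ae (hpos.mono fun w hw ↦ hint hw)
    _ = 1 := by
        simp [hν, h0.le, h0.ne']
end

section
/- Let d ≥ 1 be an integer and δ > 0, and define the weighting function w(δ, θ; d) = 2·[Γ(d/2+2, (1−θ)δ/2) − Γ(d/2+2, δ/2)] / ( δ·[Γ(d/2+1, (1−θ)δ/2) − Γ(d/2+1, δ/2)] ) for θ ∈ (0,1). Then the limit of w(δ, θ; d) as θ → 0⁺ equals 1, regardless of δ. -/
open MeasureTheory Real Filter Set

theorem integrableOn_uGamma_integrand {s x : ℝ} (hs : 0 < s) (hx : 0 ≤ x) :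
    IntegrableOn (fun t : ℝ => t ^ (s - 1) * Real.exp (-t)) (Ioi x) := by
  simpa only [mul_comm] using
    (Real.GammaIntegral_convergent hs).mono_set (Ioi_subset_Ioi hx)

theorem hasDerivAt_uGamma {s x : ℝ} (hs : 0 < s) (hx : 0 < x) :
    HasDerivAt (uGamma s) (-(x ^ (s - 1) * Real.exp (-x))) x := by
  have hcont : ContinuousOn (fun t : ℝ => t ^ (s - 1) * Real.exp (-t)) (Ioi 0) := by
    intro t ht
    exact ((Real.continuousAt_rpow_const t (s - 1) (Or.inl (ne_of_gt ht))).mul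
      (by fun_prop)).continuousWithinAt
  have hderiv : HasDerivAt (fun y => ∫ t in x..y, t ^ (s - 1) * Real.exp (-t))
      (x ^ (s - 1) * Real.exp (-x)) x :=
    intervalIntegral.integral_hasDerivAt_right IntervalIntegrable.refl
      (hcont.stronglyMeasurableAtFilter isOpen_Ioi x hx)
      (hcont.continuousAt (Ioi_mem_nhds hx))
  refine (hderiv.const_sub (uGamma s x)).congr_of_eventuallyEq ?_
  filter_upwards [Ioi_mem_nhds hx] with y hy
  exact eq_sub_of_add_eq' (intervalIntegral.integral_interval_add_Ioi
    (integrableOn_uGamma_integrand hs hx.le)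
    (integrableOn_uGamma_integrand hs (le_of_lt hy)))

theorem tendsto_uGamma_sub_div {s δ : ℝ} (hs : 0 < s) (hδ : 0 < δ) :
    Tendsto (fun θ : ℝ => (uGamma s ((1 - θ) * δ / 2) - uGamma s (δ / 2)) / θ)
      (nhdsWithin 0 (Ioi 0)) (nhds ((δ / 2) ^ s * Real.exp (-(δ / 2)))) := by
  have hδ2 : 0 < δ / 2 := by positivity
  have hlin : HasDerivAt (fun θ : ℝ => (1 - θ) * δ / 2) (-(δ / 2)) 0 := by
    have h := (((hasDerivAt_id' (0 : ℝ)).const_sub 1).mul_const δ).div_const 2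
    rwa [neg_one_mul, neg_div] at h
  have hzero : (1 - (0 : ℝ)) * δ / 2 = δ / 2 := by ring
  have hcomp : HasDerivAt (fun θ : ℝ => uGamma s ((1 - θ) * δ / 2))
      ((δ / 2) ^ s * Real.exp (-(δ / 2))) 0 := by
    have hval : -((δ / 2) ^ (s - 1) * Real.exp (-(δ / 2))) * -(δ / 2) =
        (δ / 2) ^ s * Real.exp (-(δ / 2)) := by
      rw [Real.rpow_sub_one hδ2.ne']
      field_simp
    exact hval ▸ (hasDerivAt_uGamma hs hδ2).comp_of_eq (0 : ℝ) hlin hzero.symm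
  refine (hcomp.tendsto_slope.mono_left
    (nhdsWithin_mono 0 fun θ hθ => ne_of_gt hθ)).congr fun θ => ?_
  rw [slope_def_field, hzero, sub_zero]

/-- The ECME weighting function `w(δ, θ; d)` tends to `1` as θ → 0⁺, for every δ > 0. -/
theorem weight_tendsto_one (d : ℕ) (hd : 1 ≤ d) (δ : ℝ) (hδ : 0 < δ) :
    Tendsto
      (fun θ : ℝ => 2 * (uGamma ((d : ℝ) / 2 + 2) ((1 - θ) * δ / 2) -
          uGamma ((d : ℝ) / 2 + 2) (δ / 2)) /
        (δ * (uGamma ((d : ℝ) / 2 + 1) ((1 - θ) * δ / 2) -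
          uGamma ((d : ℝ) / 2 + 1) (δ / 2))))
      (nhdsWithin 0 (Set.Ioi 0)) (nhds 1) := by
  have hδ2 : 0 < δ / 2 := by positivity
  have hnum := (tendsto_uGamma_sub_div (s := (d : ℝ) / 2 + 2) (by positivity) hδ).const_mul 2
  have hden := (tendsto_uGamma_sub_div (s := (d : ℝ) / 2 + 1) (by positivity) hδ).const_mul δ
  have hpos : 0 < (δ / 2) ^ ((d : ℝ) / 2 + 1) * Real.exp (-(δ / 2)) := by positivity
  have hlim := hnum.div hden (mul_pos hδ hpos).ne'
  have hval : 2 * ((δ / 2) ^ ((d : ℝ) / 2 + 2) * Real.exp (-(δ / 2))) /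
      (δ * ((δ / 2) ^ ((d : ℝ) / 2 + 1) * Real.exp (-(δ / 2)))) = 1 := by
    rw [div_eq_one_iff_eq (mul_pos hδ hpos).ne',
      show (d : ℝ) / 2 + 2 = (d : ℝ) / 2 + 1 + 1 by ring, Real.rpow_add_one hδ2.ne']
    ring
  rw [hval] at hlim
  refine hlim.congr' ?_
  filter_upwards [self_mem_nhdsWithin] with θ hθ
  rw [Pi.div_apply, ← mul_div_assoc, ← mul_div_assoc, div_div_div_cancel_right₀ (ne_of_gt hθ)]
end
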